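/- Let 0 < γ ≤ γ₀ and γ̃ > γ. Then the four norms N_{∞,γ}(f) = m_γ(f) + |f|_γ, N_{∞,γ,γ̃}(f) = m_γ(f) + |f|_{γ̃}, N_γ(f) = m_γ(f) + |ν(f)|, and N_{1,γ}(f) = m_γ(f) + ν(|f|) are pairwise equivalent on 𝓑_γ, and 𝓑_γ equipped with any of them is a Banach space. -/

import Mathlib

open MeasureTheory ProbabilityTheory Filter Topology
open scoped ENNReal NNReal

noncomputable section

/-- `p_λ(x) = 1 + λ d(x,x₀)` -/
def pfun {M : Type*} [MetricSpace M] (x₀ : M) (lam : ℝ) (x : M) : ℝ :=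
  1 + lam * dist x x₀

/-- `δ_λ(g) = max{c(g),1} + λ d(g x₀, x₀)` -/
def deltaFun {M G : Type*} [MetricSpace M] (x₀ : M) (act : G → M → M) (c : G → ℝ)
    (lam : ℝ) (g : G) : ℝ :=
  max (c g) 1 + lam * dist (act g x₀) x₀

/-- `δ̃(g) = 1 + c(g) + d(g x₀, x₀)` -/
def deltaTilde {M G : Type*} [MetricSpace M] (x₀ : M) (act : G → M → M) (c : G → ℝ)
    (g : G) : ℝ :=
  1 + c g + dist (act g x₀) x₀

/-- the weight `Δ_γ(x,y) = d(x,y) p(x)^γ p(y)^γ` -/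
def wDelta {M : Type*} [MetricSpace M] (x₀ : M) (lam γ : ℝ) (x y : M) : ℝ :=
  dist x y * pfun x₀ lam x ^ γ * pfun x₀ lam y ^ γ

/-- `m_γ(f)`, the best Lipschitz-type constant of `f` w.r.t. the weight `Δ_γ` -/
def mGam {M : Type*} [MetricSpace M] (x₀ : M) (lam γ : ℝ) (f : M → ℂ) : ℝ :=
  sSup {ρ : ℝ | ∃ x y : M, x ≠ y ∧ ρ = ‖f x - f y‖ / wDelta x₀ lam γ x y}

/-- `|f|_η = sup_x |f(x)|/p(x)^{η+1}` -/
def nrmGam {M : Type*} [MetricSpace M] (x₀ : M) (lam η : ℝ) (f : M → ℂ) : ℝ :=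
  sSup {ρ : ℝ | ∃ x : M, ρ = ‖f x‖ / pfun x₀ lam x ^ (η + 1)}

/-- membership in the space `𝓑_γ` -/
def memB {M : Type*} [MetricSpace M] (x₀ : M) (lam γ : ℝ) (f : M → ℂ) : Prop :=
  ∃ K : ℝ, ∀ x y : M, ‖f x - f y‖ ≤ K * wDelta x₀ lam γ x y

/-- the norm `N_{∞,γ}` on `𝓑_γ` -/
def nInf {M : Type*} [MetricSpace M] (x₀ : M) (lam γ : ℝ) (f : M → ℂ) : ℝ :=
  mGam x₀ lam γ f + nrmGam x₀ lam γ f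

/-- the Markov transition operator `P` acting on complex functions -/
def Pop {M G : Type*} [MeasurableSpace G] (π : Measure G) (act : G → M → M)
    (f : M → ℂ) (x : M) : ℂ :=
  ∫ g, f (act g x) ∂π

/-- the Markov transition operator `P` acting on real functions -/
def PopR {M G : Type*} [MeasurableSpace G] (π : Measure G) (act : G → M → M)
    (f : M → ℝ) (x : M) : ℝ :=
  ∫ g, f (act g x) ∂π

/-- the Fourier kernel `P(t)` -/
def Pt {M G : Type*} [MeasurableSpace G] (π : Measure G) (act : G → M → M)
    (ξ : G → M → ℝ) (t : ℝ) (f : M → ℂ) (x : M) : ℂ :=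
  ∫ g, Complex.exp (Complex.I * (t * ξ g x)) * f (act g x) ∂π

/-- the derivative kernels `L_k` -/
def Lk {M G : Type*} [MeasurableSpace G] (π : Measure G) (act : G → M → M)
    (ξ : G → M → ℝ) (k : ℕ) (f : M → ℂ) (x : M) : ℂ :=
  ∫ g, (Complex.I * (ξ g x : ℂ)) ^ k * f (act g x) ∂π

/-- `piStar π n` is the convolution power `π^{*(n+1)}`, the law of `R_{n+1} = Y_{n+1} ⋯ Y₁`. -/
def piStar {G : Type*} [MeasurableSpace G] [Mul G] (π : Measure G) : ℕ → Measure G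
  | 0 => π
  | n + 1 => Measure.map (fun q : G × G => q.1 * q.2) (π.prod (piStar π n))

/-- `ϑ₀ = ∫ c(g) δ_{λ₀}(g)^{2γ₀} dπ^{*n₀}(g)` (with `n₀` shifted by one). -/
def theta0 {M G : Type*} [MetricSpace M] [MeasurableSpace G] [Mul G] (x₀ : M)
    (act : G → M → M) (c : G → ℝ) (π : Measure G) (lam₀ γ₀ : ℝ) (n₀ : ℕ) : ℝ :=
  ∫ g, c g * deltaFun x₀ act c lam₀ g ^ (2 * γ₀) ∂(piStar π n₀)

/-- `𝓙^τ(U,V)` as a lower integral. -/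
def Jtau {M G : Type*} [MetricSpace M] [MeasurableSpace G] (x₀ : M) (act : G → M → M)
    (c : G → ℝ) (π : Measure G) (τ : ℝ) (U V : G → ℝ) : ℝ≥0∞ :=
  (∫⁻ g, ENNReal.ofReal (U g * (c g * deltaTilde x₀ act c g ^ (2 * τ))) ∂π) +
    ∫⁻ g, ENNReal.ofReal (V g * deltaTilde x₀ act c g ^ (τ + 1)) ∂π

/-- the random trajectory `Z_n`: `traj act Y Z n = R_n Z` where `R_n = Y_n ⋯ Y₁`
(`Y k` stands for `Y_{k+1}`). -/
def traj {M G Ω : Type*} (act : G → M → M) (Y : ℕ → Ω → G) (Z : Ω → M) : ℕ → Ω → M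
  | 0 => Z
  | n + 1 => fun ω => act (Y n ω) (traj act Y Z n ω)

/-- `S_n^Z = Σ_{k=1}^n ξ(Y_k, Z_{k-1})` -/
def Sn {M G Ω : Type*} (act : G → M → M) (ξ : G → M → ℝ) (Y : ℕ → Ω → G) (Z : Ω → M)
    (n : ℕ) (ω : Ω) : ℝ :=
  ∑ k ∈ Finset.range n, ξ (Y k ω) (traj act Y Z k ω)

/-- convergence in distribution, expressed through bounded continuous test functions -/
def CvgInDist {Ω : Type*} [MeasurableSpace Ω] (P : Measure Ω) (X : ℕ → Ω → ℝ)
    (μ : Measure ℝ) : Prop :=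
  ∀ f : ℝ → ℝ, Continuous f → (∃ C : ℝ, ∀ x, |f x| ≤ C) →
    Tendsto (fun n => ∫ ω, f (X n ω) ∂P) atTop (𝓝 (∫ x, f x ∂μ))

/-- the topological support of a measure -/
def msupport {M : Type*} [TopologicalSpace M] [MeasurableSpace M] (ν : Measure M) : Set M :=
  {x | ∀ U : Set M, IsOpen U → x ∈ U → 0 < ν U}

/-- the product `h* = h₁ ⋯ h_{k+1}` of a tuple of elements of the semigroup `G` -/
def hstar {G : Type*} [Semigroup G] : ∀ {k : ℕ}, (Fin (k + 1) → G) → G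
  | 0, h => h 0
  | _ + 1, h => h 0 * hstar (Fin.tail h)


/-- the four norms `N_{∞,γ}`, `N_{∞,γ,γ̃}`, `N_γ`, `N_{1,γ}` on `𝓑_γ` -/
def fourNorms {M : Type*} [MetricSpace M] [MeasurableSpace M] (x₀ : M)
    (lam γ γt : ℝ) (ν : Measure M) : Fin 4 → (M → ℂ) → ℝ :=
  ![fun f => mGam x₀ lam γ f + nrmGam x₀ lam γ f,
    fun f => mGam x₀ lam γ f + nrmGam x₀ lam γt f,
    fun f => mGam x₀ lam γ f + ‖∫ x, f x ∂ν‖,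
    fun f => mGam x₀ lam γ f + ∫ x, ‖f x‖ ∂ν]

section Weights

variable {M : Type*} [MetricSpace M] {x₀ : M} {lam γ η : ℝ} {f : M → ℂ}

lemma one_le_pfun (hl : 0 < lam) (x : M) : 1 ≤ pfun x₀ lam x :=
  le_add_of_nonneg_right (by positivity)

lemma pfun_pos (hl : 0 < lam) (x : M) : 0 < pfun x₀ lam x :=
  zero_lt_one.trans_le (one_le_pfun hl x)

@[simp] lemma pfun_self : pfun x₀ lam x₀ = 1 := by simp [pfun]

lemma continuous_pfun_rpow (hl : 0 < lam) (s : ℝ) :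
    Continuous fun x => pfun x₀ lam x ^ s := by
  refine Continuous.rpow_const ?_ fun x => Or.inl (pfun_pos hl x).ne'
  unfold pfun
  fun_prop

lemma wDelta_pos (hl : 0 < lam) {x y : M} (h : x ≠ y) : 0 < wDelta x₀ lam γ x y :=
  mul_pos (mul_pos (dist_pos.2 h) (Real.rpow_pos_of_pos (pfun_pos hl x) _))
    (Real.rpow_pos_of_pos (pfun_pos hl y) _)

lemma wDelta_base_le (hl : 0 < lam) (x : M) :
    wDelta x₀ lam γ x x₀ ≤ lam⁻¹ * pfun x₀ lam x ^ (γ + 1) := by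
  have hd : dist x x₀ ≤ lam⁻¹ * pfun x₀ lam x := by
    rw [pfun, mul_add, inv_mul_cancel_left₀ hl.ne']
    exact le_add_of_nonneg_left (by positivity)
  have hp := (Real.rpow_pos_of_pos (pfun_pos (x₀ := x₀) hl x) γ).le
  calc wDelta x₀ lam γ x x₀ = dist x x₀ * pfun x₀ lam x ^ γ := by simp [wDelta]
    _ ≤ lam⁻¹ * pfun x₀ lam x * pfun x₀ lam x ^ γ := mul_le_mul_of_nonneg_right hd hp
    _ = lam⁻¹ * pfun x₀ lam x ^ (γ + 1) := by
      rw [Real.rpow_add_one (pfun_pos hl x).ne']; ring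

lemma mGam_nonneg (hl : 0 < lam) : 0 ≤ mGam x₀ lam γ f := by
  refine Real.sSup_nonneg ?_
  rintro _ ⟨x, y, h, rfl⟩
  exact div_nonneg (norm_nonneg _) (wDelta_pos hl h).le

lemma mGam_le (hl : 0 < lam) {K : ℝ} (hK : 0 ≤ K)
    (h : ∀ x y, ‖f x - f y‖ ≤ K * wDelta x₀ lam γ x y) : mGam x₀ lam γ f ≤ K := by
  refine Real.sSup_le ?_ hK
  rintro _ ⟨x, y, hxy, rfl⟩
  exact (div_le_iff₀ (wDelta_pos hl hxy)).2 (h x y)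

lemma memB.norm_sub_le_mGam (hl : 0 < lam) (hf : memB x₀ lam γ f) (x y : M) :
    ‖f x - f y‖ ≤ mGam x₀ lam γ f * wDelta x₀ lam γ x y := by
  obtain ⟨K, hK⟩ := hf
  rcases eq_or_ne x y with rfl | hxy
  · simp [wDelta]
  · rw [← div_le_iff₀ (wDelta_pos hl hxy)]
    refine le_csSup ⟨K, ?_⟩ ⟨x, y, hxy, rfl⟩
    rintro _ ⟨x, y, hxy, rfl⟩
    exact (div_le_iff₀ (wDelta_pos hl hxy)).2 (hK x y)

lemma memB.sub {g : M → ℂ} (hf : memB x₀ lam γ f) (hg : memB x₀ lam γ g) :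
    memB x₀ lam γ (f - g) := by
  obtain ⟨K, hK⟩ := hf
  obtain ⟨L, hL⟩ := hg
  refine ⟨K + L, fun x y => ?_⟩
  calc ‖(f - g) x - (f - g) y‖ = ‖(f x - f y) - (g x - g y)‖ := by
        simp only [Pi.sub_apply]; congr 1; ring
    _ ≤ ‖f x - f y‖ + ‖g x - g y‖ := norm_sub_le _ _
    _ ≤ _ := by rw [add_mul]; exact add_le_add (hK x y) (hL x y)

lemma memB.continuous (hl : 0 < lam) (hf : memB x₀ lam γ f) : Continuous f := by
  obtain ⟨K, hK⟩ := hf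
  refine continuous_iff_continuousAt.2 fun y => tendsto_iff_norm_sub_tendsto_zero.2 ?_
  refine squeeze_zero (fun _ => norm_nonneg _) (fun x => hK x y) ?_
  have h : Continuous fun x => K * wDelta x₀ lam γ x y := by
    have := continuous_pfun_rpow (x₀ := x₀) hl γ
    unfold wDelta
    fun_prop
  simpa [wDelta] using h.tendsto y

/-- The norm `m_γ(f) + |f(x₀)|`, which serves as a common reference. -/
def baseNorm (x₀ : M) (lam γ : ℝ) (f : M → ℂ) : ℝ :=
  mGam x₀ lam γ f + ‖f x₀‖

lemma memB.norm_sub_base_le (hl : 0 < lam) (hf : memB x₀ lam γ f) (x : M) :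
    ‖f x - f x₀‖ ≤ mGam x₀ lam γ f * lam⁻¹ * pfun x₀ lam x ^ (γ + 1) := by
  rw [mul_assoc]
  exact (hf.norm_sub_le_mGam hl x x₀).trans
    (mul_le_mul_of_nonneg_left (wDelta_base_le hl x) (mGam_nonneg hl))

lemma memB.norm_le (hl : 0 < lam) (hγ : 0 < γ) (hf : memB x₀ lam γ f) (x : M) :
    ‖f x‖ ≤ (1 + lam⁻¹) * baseNorm x₀ lam γ f * pfun x₀ lam x ^ (γ + 1) := by
  have h1 := hf.norm_sub_base_le hl x
  have h2 : ‖f x‖ ≤ ‖f x - f x₀‖ + ‖f x₀‖ := by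
    simpa using norm_add_le (f x - f x₀) (f x₀)
  have h3 : 1 ≤ pfun x₀ lam x ^ (γ + 1) := Real.one_le_rpow (one_le_pfun hl x) (by linarith)
  have h4 := le_mul_of_one_le_right (norm_nonneg (f x₀)) h3
  have h5 : 0 ≤ mGam x₀ lam γ f := mGam_nonneg hl
  have h6 : 0 < lam⁻¹ := inv_pos.2 hl
  have h7 : 0 ≤ (mGam x₀ lam γ f + lam⁻¹ * ‖f x₀‖) * pfun x₀ lam x ^ (γ + 1) := by positivity
  unfold baseNorm
  linarith

lemma memB.norm_div_rpow_le (hl : 0 < lam) (hγ : 0 < γ) (hη : γ ≤ η) (hf : memB x₀ lam γ f) (x : M) :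
    ‖f x‖ / pfun x₀ lam x ^ (η + 1) ≤ (1 + lam⁻¹) * baseNorm x₀ lam γ f := by
  rw [div_le_iff₀ (Real.rpow_pos_of_pos (pfun_pos hl x) _)]
  refine (hf.norm_le hl hγ x).trans (mul_le_mul_of_nonneg_left ?_ ?_)
  · exact Real.rpow_le_rpow_of_exponent_le (one_le_pfun hl x) (by linarith)
  · have : 0 ≤ mGam x₀ lam γ f := mGam_nonneg hl
    unfold baseNorm
    positivity

lemma memB.nrmGam_le (hl : 0 < lam) (hγ : 0 < γ) (hη : γ ≤ η) (hf : memB x₀ lam γ f) :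
    nrmGam x₀ lam η f ≤ (1 + lam⁻¹) * baseNorm x₀ lam γ f := by
  refine csSup_le ⟨_, x₀, rfl⟩ ?_
  rintro _ ⟨x, rfl⟩
  exact hf.norm_div_rpow_le hl hγ hη x

lemma memB.norm_base_le_nrmGam (hl : 0 < lam) (hγ : 0 < γ) (hη : γ ≤ η)
    (hf : memB x₀ lam γ f) : ‖f x₀‖ ≤ nrmGam x₀ lam η f := by
  refine le_csSup ⟨(1 + lam⁻¹) * baseNorm x₀ lam γ f, ?_⟩ ⟨x₀, by simp⟩
  rintro _ ⟨x, rfl⟩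
  exact hf.norm_div_rpow_le hl hγ hη x

/-- Completeness of `𝓑_γ` for the reference norm. -/
lemma exists_tendsto_baseNorm (hl : 0 < lam) (hγ : 0 < γ) (u : ℕ → M → ℂ)
    (hu : ∀ n, memB x₀ lam γ (u n))
    (hC : ∀ ε : ℝ, 0 < ε → ∃ N : ℕ, ∀ m ≥ N, ∀ n ≥ N, baseNorm x₀ lam γ (u m - u n) < ε) :
    ∃ f : M → ℂ, memB x₀ lam γ f ∧
      Tendsto (fun n => baseNorm x₀ lam γ (u n - f)) atTop (𝓝 0) := by
  have hlim : ∀ x, ∃ z, Tendsto (fun n => u n x) atTop (𝓝 z) := by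
    intro x
    refine cauchySeq_tendsto_of_complete (Metric.cauchySeq_iff.2 fun ε hε => ?_)
    have hA : 0 < (1 + lam⁻¹) * pfun x₀ lam x ^ (γ + 1) :=
      mul_pos (by positivity) (Real.rpow_pos_of_pos (pfun_pos hl x) _)
    obtain ⟨N, hN⟩ := hC (ε / ((1 + lam⁻¹) * pfun x₀ lam x ^ (γ + 1))) (by positivity)
    refine ⟨N, fun m hm n hn => ?_⟩
    have h1 := ((hu m).sub (hu n)).norm_le hl hγ x
    have h2 := (lt_div_iff₀ hA).1 (hN m hm n hn)
    rw [dist_eq_norm]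
    simp only [Pi.sub_apply] at h1
    linarith
  choose f hf using hlim
  have key : ∀ ε : ℝ, 0 < ε → ∃ N : ℕ, ∀ n ≥ N,
      (∀ x y, ‖(u n - f) x - (u n - f) y‖ ≤ ε * wDelta x₀ lam γ x y) ∧
        ‖(u n - f) x₀‖ ≤ ε := by
    intro ε hε
    obtain ⟨N, hN⟩ := hC ε hε
    refine ⟨N, fun n hn => ⟨fun x y => ?_, ?_⟩⟩
    · have ht : Tendsto (fun m => ‖(u n - u m) x - (u n - u m) y‖) atTop
          (𝓝 ‖(u n - f) x - (u n - f) y‖) :=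
        ((tendsto_const_nhds.sub (hf x)).sub (tendsto_const_nhds.sub (hf y))).norm
      refine le_of_tendsto ht (eventually_atTop.2 ⟨N, fun m hm => ?_⟩)
      refine (((hu n).sub (hu m)).norm_sub_le_mGam hl x y).trans
        (mul_le_mul_of_nonneg_right ?_ ?_)
      · exact (le_add_of_nonneg_right (norm_nonneg _)).trans (hN n hn m hm).le
      · rcases eq_or_ne x y with rfl | h
        · simp [wDelta]
        · exact (wDelta_pos hl h).le
    · have ht : Tendsto (fun m => ‖(u n - u m) x₀‖) atTop (𝓝 ‖(u n - f) x₀‖) :=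
        (tendsto_const_nhds.sub (hf x₀)).norm
      refine le_of_tendsto ht (eventually_atTop.2 ⟨N, fun m hm => ?_⟩)
      exact (le_add_of_nonneg_left (mGam_nonneg hl)).trans (hN n hn m hm).le
  refine ⟨f, ?_, ?_⟩
  · obtain ⟨N, hN⟩ := key 1 one_pos
    have := (hu N).sub ⟨1, (hN N le_rfl).1⟩
    rwa [sub_sub_cancel] at this
  · refine Metric.tendsto_atTop.2 fun ε hε => ?_
    obtain ⟨N, hN⟩ := key (ε / 3) (by positivity)
    refine ⟨N, fun n hn => ?_⟩
    obtain ⟨h1, h2⟩ := hN n hn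
    have h3 := mGam_le hl (by positivity) h1
    have h4 : 0 ≤ mGam x₀ lam γ (u n - f) := mGam_nonneg hl
    rw [Real.dist_0_eq_abs, abs_of_nonneg]
    · unfold baseNorm
      linarith
    · exact add_nonneg h4 (norm_nonneg _)

variable [MeasurableSpace M] [BorelSpace M] {ν : Measure M}

lemma memB.integrable (hl : 0 < lam) (hγ : 0 < γ) (hf : memB x₀ lam γ f)
    (hI : Integrable (fun x => pfun x₀ lam x ^ (γ + 1)) ν) : Integrable f ν :=
  (hI.const_mul _).mono' (hf.continuous hl).aestronglyMeasurable
    (ae_of_all _ (hf.norm_le hl hγ))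

lemma memB.integral_norm_le (hl : 0 < lam) (hγ : 0 < γ) (hf : memB x₀ lam γ f)
    (hI : Integrable (fun x => pfun x₀ lam x ^ (γ + 1)) ν) :
    ∫ x, ‖f x‖ ∂ν ≤ (1 + lam⁻¹) * (∫ x, pfun x₀ lam x ^ (γ + 1) ∂ν) * baseNorm x₀ lam γ f :=
  calc ∫ x, ‖f x‖ ∂ν
      ≤ ∫ x, (1 + lam⁻¹) * baseNorm x₀ lam γ f * pfun x₀ lam x ^ (γ + 1) ∂ν :=
        integral_mono (hf.integrable hl hγ hI).norm (hI.const_mul _) (hf.norm_le hl hγ)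
    _ = _ := by rw [integral_const_mul]; ring

lemma memB.norm_base_le_integral [IsProbabilityMeasure ν] (hl : 0 < lam) (hγ : 0 < γ) (hf : memB x₀ lam γ f)
    (hI : Integrable (fun x => pfun x₀ lam x ^ (γ + 1)) ν) :
    ‖f x₀‖ ≤ ‖∫ x, f x ∂ν‖ +
      mGam x₀ lam γ f * lam⁻¹ * ∫ x, pfun x₀ lam x ^ (γ + 1) ∂ν := by
  have hfi := hf.integrable hl hγ hI
  have h1 : ‖∫ x, (f x - f x₀) ∂ν‖ ≤
      mGam x₀ lam γ f * lam⁻¹ * ∫ x, pfun x₀ lam x ^ (γ + 1) ∂ν := by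
    rw [← integral_const_mul]
    exact norm_integral_le_of_norm_le (hI.const_mul _) (ae_of_all _ (hf.norm_sub_base_le hl))
  rw [integral_sub hfi (integrable_const _), integral_const] at h1
  simp only [probReal_univ, one_smul] at h1
  have h2 := norm_sub_le (∫ x, f x ∂ν) (∫ x, f x ∂ν - f x₀)
  rw [sub_sub_cancel] at h2
  linarith

/-- Each of the four norms is equivalent to the reference norm. -/
lemma fourNorms_equiv_baseNorm [IsProbabilityMeasure ν] {γt : ℝ} (hl : 0 < lam) (hγ : 0 < γ) (hγt : γ < γt)
    (hI : Integrable (fun x => pfun x₀ lam x ^ (γ + 1)) ν) (i : Fin 4) :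
    ∃ C : ℝ, 0 < C ∧ ∀ f : M → ℂ, memB x₀ lam γ f →
      fourNorms x₀ lam γ γt ν i f ≤ C * baseNorm x₀ lam γ f ∧
        baseNorm x₀ lam γ f ≤ C * fourNorms x₀ lam γ γt ν i f := by
  set I := ∫ x, pfun x₀ lam x ^ (γ + 1) ∂ν with hIdef
  have hI1 : 0 ≤ I := integral_nonneg fun x => (Real.rpow_pos_of_pos (pfun_pos hl x) _).le
  have hl' : 0 < lam⁻¹ := inv_pos.2 hl
  have hD : 0 ≤ lam⁻¹ * I := by positivity
  refine ⟨1 + (1 + lam⁻¹) * (1 + I), by positivity, fun f hf => ?_⟩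
  have hm : 0 ≤ mGam x₀ lam γ f := mGam_nonneg hl
  have hx : 0 ≤ ‖f x₀‖ := norm_nonneg _
  have e1 := hf.nrmGam_le hl hγ le_rfl
  have e2 := hf.nrmGam_le hl hγ hγt.le
  have e3 := hf.integral_norm_le hl hγ hI
  have e4 : ‖∫ x, f x ∂ν‖ ≤ ∫ x, ‖f x‖ ∂ν := norm_integral_le_integral_norm _
  have l1 := hf.norm_base_le_nrmGam hl hγ le_rfl
  have l2 := hf.norm_base_le_nrmGam hl hγ hγt.le
  have l3 := hf.norm_base_le_integral hl hγ hI
  rw [← hIdef] at e3 l3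
  have hb : 0 ≤ baseNorm x₀ lam γ f := add_nonneg hm hx
  have upper : ∀ t, (t ≤ (1 + lam⁻¹) * baseNorm x₀ lam γ f ∨
      t ≤ (1 + lam⁻¹) * I * baseNorm x₀ lam γ f) →
      mGam x₀ lam γ f + t ≤ (1 + (1 + lam⁻¹) * (1 + I)) * baseNorm x₀ lam γ f := by
    intro t ht
    have h1 : mGam x₀ lam γ f ≤ baseNorm x₀ lam γ f := le_add_of_nonneg_right hx
    have h2 : 0 ≤ (1 + lam⁻¹) * baseNorm x₀ lam γ f := by positivity
    have h3 : 0 ≤ (1 + lam⁻¹) * I * baseNorm x₀ lam γ f := by positivity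
    rcases ht with ht | ht <;> linarith
  have lower : ∀ t, 0 ≤ t → ‖f x₀‖ ≤ t + mGam x₀ lam γ f * lam⁻¹ * I →
      baseNorm x₀ lam γ f ≤ (1 + (1 + lam⁻¹) * (1 + I)) * (mGam x₀ lam γ f + t) := by
    intro t ht h
    have h1 : 0 ≤ (1 + lam⁻¹ + I) * (mGam x₀ lam γ f + t) := by positivity
    have h2 : 0 ≤ lam⁻¹ * I * t := by positivity
    unfold baseNorm
    linarith
  have hmi : 0 ≤ mGam x₀ lam γ f * lam⁻¹ * I := by positivity
  fin_cases i
  · exact ⟨upper _ (Or.inl e1), lower _ (hx.trans l1) (by linarith)⟩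
  · exact ⟨upper _ (Or.inl e2), lower _ (hx.trans l2) (by linarith)⟩
  · exact ⟨upper _ (Or.inr (e4.trans e3)), lower _ (norm_nonneg _) l3⟩
  · exact ⟨upper _ (Or.inr e3), lower _ ((norm_nonneg _).trans e4) (by linarith)⟩

end Weights

section Moments

/-- A Foster–Lyapunov drift condition bounds the integral of the Lyapunov function under any
invariant probability measure. -/
lemma lintegral_ne_top_of_drift {M G : Type*} [MeasurableSpace M] [MeasurableSpace G]
    {act : G → M → M} {Q : Measure G} [IsProbabilityMeasure Q]
    {ν : Measure M} [IsProbabilityMeasure ν]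
    (hinv : ∀ f : M → ℝ≥0∞, Measurable f → ∫⁻ x, ∫⁻ g, f (act g x) ∂Q ∂ν = ∫⁻ x, f x ∂ν)
    {V : M → ℝ≥0∞} (hV : Measurable V) (hVfin : ∀ x, V x ≠ ⊤) {a b : ℝ≥0∞} (ha : a < 1)
    (hb : b ≠ ⊤) (hdrift : ∀ x, ∫⁻ g, V (act g x) ∂Q ≤ a * V x + b) :
    ∫⁻ x, V x ∂ν ≠ ⊤ := by
  have hms : ∀ n : ℕ, MeasurableSet {x | V x ≤ n} := fun n => measurableSet_le hV measurable_const
  have hb' : ∀ n : ℕ, (1 - a) * ∫⁻ x, {x | V x ≤ n}.indicator V x ∂ν ≤ b := by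
    intro n
    have hfin : ∫⁻ x, min (a * V x + b) n ∂ν ≠ ⊤ := by
      refine ne_top_of_le_ne_top (ENNReal.natCast_ne_top n)
        ((lintegral_mono fun x => min_le_right _ _).trans ?_)
      simp
    have h1 : ∫⁻ x, min (V x) n ∂ν ≤ ∫⁻ x, min (a * V x + b) n ∂ν := by
      rw [← hinv _ (hV.min measurable_const)]
      refine lintegral_mono fun x => le_min ?_ ?_
      · exact (lintegral_mono fun g => min_le_left _ _).trans (hdrift x)
      · refine (lintegral_mono fun g => min_le_right _ _).trans ?_
        simp
    have h2 : ∫⁻ x, ((1 - a) * {x | V x ≤ n}.indicator V x + min (a * V x + b) n) ∂ν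
        ≤ ∫⁻ x, (min (V x) n + b) ∂ν := by
      refine lintegral_mono fun x => ?_
      by_cases hx : V x ≤ n
      · rw [Set.indicator_of_mem (show x ∈ {x | V x ≤ n} from hx), min_eq_left hx]
        refine (add_le_add_right (min_le_left _ _) _).trans ?_
        rw [← add_assoc, ← add_mul, tsub_add_cancel_of_le ha.le, one_mul]
      · rw [Set.indicator_of_notMem (show x ∉ {x | V x ≤ n} from hx),
          min_eq_right (not_le.1 hx).le]
        simp only [mul_zero, zero_add]
        exact (min_le_right _ _).trans le_self_add
    rw [lintegral_add_left ((hV.indicator (hms n)).const_mul _),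
      lintegral_const_mul _ (hV.indicator (hms n)), lintegral_add_right _ measurable_const] at h2
    simp only [lintegral_const, measure_univ, mul_one] at h2
    refine (ENNReal.add_le_add_iff_right hfin).1 (h2.trans ?_)
    rw [add_comm b]
    exact add_le_add_left h1 b
  have hsup : V = fun x => ⨆ n : ℕ, {x | V x ≤ n}.indicator V x := by
    funext x
    refine le_antisymm ?_ (iSup_le fun n => Set.indicator_le_self _ _ _)
    obtain ⟨n, hn⟩ := ENNReal.exists_nat_gt (hVfin x)
    refine le_iSup_of_le n ?_
    rw [Set.indicator_of_mem (show x ∈ {x | V x ≤ n} from hn.le)]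
  have hmono : Monotone fun (n : ℕ) x => {x | V x ≤ n}.indicator V x := by
    intro n m hnm x
    refine Set.indicator_le_indicator_of_subset (fun y (hy : V y ≤ n) => ?_) (fun _ => zero_le) x
    exact hy.trans (by exact_mod_cast hnm)
  have hpos : 1 - a ≠ 0 := (tsub_pos_of_lt ha).ne'
  have hne : 1 - a ≠ ⊤ := ne_top_of_le_ne_top ENNReal.one_ne_top tsub_le_self
  rw [hsup, lintegral_iSup (fun n => hV.indicator (hms n)) hmono]
  refine ne_top_of_le_ne_top (ENNReal.div_ne_top hb hpos) (iSup_le fun n => ?_)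
  rw [ENNReal.le_div_iff_mul_le (Or.inl hpos) (Or.inl hne), mul_comm]
  exact hb' n

lemma measurable_act_apply {M G : Type*} [MeasurableSpace M] [MeasurableSpace G]
    {act : G → M → M} (hactm : Measurable fun q : G × M => act q.1 q.2) (x : M) :
    Measurable fun g => act g x :=
  hactm.comp (measurable_id.prodMk measurable_const)

lemma isProbabilityMeasure_piStar {G : Type*} [MeasurableSpace G] [Mul G] [MeasurableMul₂ G]
    {π : Measure G} [IsProbabilityMeasure π] (n : ℕ) :
    IsProbabilityMeasure (piStar π n) := by
  induction n with
  | zero => assumption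
  | succ n ih => exact Measure.isProbabilityMeasure_map measurable_mul.aemeasurable

lemma lintegral_act_piStar {M G : Type*} [MeasurableSpace M] [MeasurableSpace G] [Mul G]
    [MeasurableMul₂ G] {act : G → M → M} {π : Measure G} [IsProbabilityMeasure π]
    (hact : ∀ (g h : G) (x : M), act (g * h) x = act g (act h x))
    (hactm : Measurable fun q : G × M => act q.1 q.2)
    {ν : Measure M} [IsProbabilityMeasure ν]
    (hν : Measure.map (fun q : G × M => act q.1 q.2) (π.prod ν) = ν) (n : ℕ)
    {f : M → ℝ≥0∞} (hf : Measurable f) :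
    ∫⁻ x, ∫⁻ g, f (act g x) ∂(piStar π n) ∂ν = ∫⁻ x, f x ∂ν := by
  have h0 : ∀ f : M → ℝ≥0∞, Measurable f →
      ∫⁻ g, ∫⁻ x, f (act g x) ∂ν ∂π = ∫⁻ x, f x ∂ν := by
    intro f hf
    conv_rhs => rw [← hν]
    rw [lintegral_map hf hactm]
    exact (lintegral_prod _ (hf.comp hactm).aemeasurable).symm
  have hprob := isProbabilityMeasure_piStar (π := π)
  induction n generalizing f with
  | zero =>
    rw [← h0 f hf]
    exact lintegral_lintegral_swap (ν := π) ((hf.comp hactm).comp measurable_swap).aemeasurable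
  | succ n ih =>
    have hg : ∀ g, Measurable fun x => f (act g x) := fun g =>
      hf.comp (hactm.comp (measurable_const.prodMk measurable_id))
    have h3 : Measurable fun q : (M × G) × G => f (act q.1.2 (act q.2 q.1.1)) :=
      hf.comp (hactm.comp (measurable_fst.snd.prodMk
        (hactm.comp (measurable_snd.prodMk measurable_fst.fst))))
    calc ∫⁻ x, ∫⁻ g, f (act g x) ∂(piStar π (n + 1)) ∂ν
        = ∫⁻ x, ∫⁻ g, ∫⁻ h, f (act g (act h x)) ∂(piStar π n) ∂π ∂ν := by
          refine lintegral_congr fun x => ?_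
          have hx : Measurable fun g => f (act g x) := hf.comp (measurable_act_apply hactm x)
          rw [piStar, lintegral_map hx measurable_mul]
          refine (lintegral_prod _ (hx.comp measurable_mul).aemeasurable).trans ?_
          simp only [Function.comp_apply, hact]
      _ = ∫⁻ g, ∫⁻ x, ∫⁻ h, f (act g (act h x)) ∂(piStar π n) ∂ν ∂π :=
          lintegral_lintegral_swap h3.lintegral_prod_right'.aemeasurable
      _ = ∫⁻ g, ∫⁻ x, f (act g x) ∂ν ∂π :=
          lintegral_congr fun g => ih (hg g)
      _ = ∫⁻ x, f x ∂ν := h0 f hf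

variable {M : Type*} [MetricSpace M] {x₀ : M} {G : Type*} {act : G → M → M} {c : G → ℝ}

lemma one_le_deltaTilde (hc0 : ∀ g, 0 ≤ c g) (g : G) : 1 ≤ deltaTilde x₀ act c g := by
  have := hc0 g
  have : 0 ≤ dist (act g x₀) x₀ := dist_nonneg
  unfold deltaTilde
  linarith

lemma deltaTilde_mul_le [Mul G] (hact : ∀ (g h : G) (x : M), act (g * h) x = act g (act h x))
    (hc0 : ∀ g : G, 0 ≤ c g)
    (hcLip : ∀ (g : G) (x y : M), dist (act g x) (act g y) ≤ c g * dist x y)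
    (hcMin : ∀ (g : G) (K : ℝ), 0 ≤ K →
      (∀ x y : M, dist (act g x) (act g y) ≤ K * dist x y) → c g ≤ K) (g h : G) :
    deltaTilde x₀ act c (g * h) ≤ deltaTilde x₀ act c g * deltaTilde x₀ act c h := by
  have h1 : c (g * h) ≤ c g * c h := by
    refine hcMin _ _ (mul_nonneg (hc0 g) (hc0 h)) fun x y => ?_
    rw [hact, hact, mul_assoc]
    exact (hcLip g _ _).trans (mul_le_mul_of_nonneg_left (hcLip h x y) (hc0 g))
  have h2 : dist (act (g * h) x₀) x₀ ≤ c g * dist (act h x₀) x₀ + dist (act g x₀) x₀ := by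
    rw [hact]
    exact (dist_triangle _ (act g x₀) _).trans (by gcongr; exact hcLip g _ _)
  have a1 := hc0 g
  have a2 := hc0 h
  have a3 : 0 ≤ dist (act g x₀) x₀ := dist_nonneg
  have a4 : 0 ≤ dist (act h x₀) x₀ := dist_nonneg
  unfold deltaTilde
  nlinarith [mul_nonneg a1 a2, mul_nonneg a3 a2, mul_nonneg a3 a4]

variable [MeasurableSpace M] [BorelSpace M] [SecondCountableTopology M] [MeasurableSpace G]
  {π : Measure G} [IsProbabilityMeasure π]

lemma measurable_deltaTilde (hactm : Measurable fun q : G × M => act q.1 q.2)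
    (hcm : Measurable c) : Measurable (deltaTilde x₀ act c) :=
  (measurable_const.add hcm).add ((measurable_act_apply hactm x₀).dist measurable_const)

lemma lintegral_deltaTilde_piStar_lt_top [Mul G] [MeasurableMul₂ G]
    (hact : ∀ (g h : G) (x : M), act (g * h) x = act g (act h x))
    (hactm : Measurable fun q : G × M => act q.1 q.2) (hcm : Measurable c)
    (hc0 : ∀ g : G, 0 ≤ c g)
    (hcLip : ∀ (g : G) (x y : M), dist (act g x) (act g y) ≤ c g * dist x y)
    (hcMin : ∀ (g : G) (K : ℝ), 0 ≤ K →
      (∀ x y : M, dist (act g x) (act g y) ≤ K * dist x y) → c g ≤ K)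
    {s : ℝ} (hs : 0 ≤ s)
    (hM : ∫⁻ g, ENNReal.ofReal (deltaTilde x₀ act c g ^ s) ∂π < ⊤) (n : ℕ) :
    ∫⁻ g, ENNReal.ofReal (deltaTilde x₀ act c g ^ s) ∂(piStar π n) < ⊤ := by
  have hm : Measurable fun g => ENNReal.ofReal (deltaTilde x₀ act c g ^ s) :=
    ((measurable_deltaTilde hactm hcm).pow_const s).ennreal_ofReal
  induction n with
  | zero => exact hM
  | succ n ih =>
    have := isProbabilityMeasure_piStar (π := π) n
    rw [piStar, lintegral_map hm measurable_mul]
    refine lt_of_le_of_lt (lintegral_mono (g := fun q : G × G =>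
      ENNReal.ofReal (deltaTilde x₀ act c q.1 ^ s) *
        ENNReal.ofReal (deltaTilde x₀ act c q.2 ^ s)) fun q => ?_) ?_
    · have p1 := one_le_deltaTilde (x₀ := x₀) (act := act) hc0
      have p0 : ∀ g, 0 ≤ deltaTilde x₀ act c g := fun g => zero_le_one.trans (p1 g)
      dsimp only
      rw [← ENNReal.ofReal_mul (Real.rpow_nonneg (p0 _) _), ← Real.mul_rpow (p0 _) (p0 _)]
      exact ENNReal.ofReal_le_ofReal (Real.rpow_le_rpow (p0 _)
        (deltaTilde_mul_le hact hc0 hcLip hcMin _ _) hs)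
    · rw [lintegral_prod_mul hm.aemeasurable hm.aemeasurable]
      exact ENNReal.mul_lt_top hM ih

lemma add_rpow_le_of_one_lt {r s u v : ℝ} (hr : 1 < r) (hs : 0 ≤ s) (hu : 0 ≤ u) (hv : 0 ≤ v) :
    (u + v) ^ s ≤ r ^ s * u ^ s + (r / (r - 1)) ^ s * v ^ s := by
  have hr1 : 0 < r - 1 := sub_pos.2 hr
  have hq : 0 ≤ r / (r - 1) := by positivity
  have hr0 : 0 ≤ r := by linarith
  rw [← Real.mul_rpow hr0 hu, ← Real.mul_rpow hq hv]
  have h1 := Real.rpow_nonneg (mul_nonneg hr0 hu) s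
  have h2 := Real.rpow_nonneg (mul_nonneg hq hv) s
  rcases le_total v ((r - 1) * u) with h | h
  · have := Real.rpow_le_rpow (add_nonneg hu hv) (show u + v ≤ r * u by linarith) hs
    linarith
  · have h3 : u + v ≤ r / (r - 1) * v := by
      rw [div_mul_eq_mul_div, le_div_iff₀ hr1]
      linarith
    have := Real.rpow_le_rpow (add_nonneg hu hv) h3 hs
    linarith

lemma exists_one_lt_rpow_mul_lt {s : ℝ} {A : ℝ≥0∞} (hA : A < 1) :
    ∃ r : ℝ, 1 < r ∧ ENNReal.ofReal (r ^ s) * A < 1 := by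
  have h : Tendsto (fun r : ℝ => ENNReal.ofReal (r ^ s) * A) (𝓝[>] 1) (𝓝 A) := by
    have h1 : Tendsto (fun r : ℝ => r ^ s) (𝓝 1) (𝓝 1) := by
      simpa using (Real.continuousAt_rpow_const 1 s (Or.inl one_ne_zero)).tendsto
    have h2 := ENNReal.Tendsto.mul_const (b := A) (ENNReal.tendsto_ofReal h1) (Or.inl (by simp))
    simpa using h2.mono_left nhdsWithin_le_nhds
  obtain ⟨r, h1, h2⟩ := ((h.eventually_lt_const hA).and self_mem_nhdsWithin).exists
  exact ⟨r, h2, h1⟩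

/-- The invariant measure has a finite moment of order `γ₀ + 1`. -/
lemma lintegral_dist_rpow_ne_top [Mul G] [MeasurableMul₂ G]
    (hact : ∀ (g h : G) (x : M), act (g * h) x = act g (act h x))
    (hactm : Measurable fun q : G × M => act q.1 q.2) (hcm : Measurable c)
    (hc0 : ∀ g : G, 0 ≤ c g)
    (hcLip : ∀ (g : G) (x y : M), dist (act g x) (act g y) ≤ c g * dist x y)
    (hcMin : ∀ (g : G) (K : ℝ), 0 ≤ K →
      (∀ x y : M, dist (act g x) (act g y) ≤ K * dist x y) → c g ≤ K)
    {γ₀ : ℝ} (hγ₀ : 0 < γ₀) {n₀ : ℕ}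
    (hM : ∫⁻ g, ENNReal.ofReal (deltaTilde x₀ act c g ^ (γ₀ + 1)) ∂π < ⊤)
    (hC : ∫⁻ g, ENNReal.ofReal (c g * max (c g) 1 ^ (2 * γ₀)) ∂(piStar π n₀) < 1)
    {ν : Measure M} [IsProbabilityMeasure ν]
    (hν : Measure.map (fun q : G × M => act q.1 q.2) (π.prod ν) = ν) :
    ∫⁻ x, ENNReal.ofReal (dist x x₀ ^ (γ₀ + 1)) ∂ν ≠ ⊤ := by
  have := isProbabilityMeasure_piStar (π := π) n₀
  have hs : 0 ≤ γ₀ + 1 := by linarith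
  have hA : ∫⁻ g, ENNReal.ofReal (c g ^ (γ₀ + 1)) ∂(piStar π n₀) < 1 := by
    refine lt_of_le_of_lt (lintegral_mono fun g => ENNReal.ofReal_le_ofReal ?_) hC
    rw [Real.rpow_add_one' (hc0 g) (by positivity), mul_comm]
    refine mul_le_mul_of_nonneg_left ?_ (hc0 g)
    exact (Real.rpow_le_rpow (hc0 g) (le_max_left _ 1) hγ₀.le).trans
      (Real.rpow_le_rpow_of_exponent_le (le_max_right _ _) (by linarith))
  obtain ⟨r, hr, hrA⟩ := exists_one_lt_rpow_mul_lt (s := γ₀ + 1) hA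
  have hr0 : 0 < r := by linarith
  have hq : 0 ≤ r / (r - 1) := div_nonneg hr0.le (by linarith)
  have hB := lintegral_deltaTilde_piStar_lt_top hact hactm hcm hc0 hcLip hcMin hs hM n₀
  have hmc : Measurable fun g => ENNReal.ofReal (c g ^ (γ₀ + 1)) :=
    (hcm.pow_const _).ennreal_ofReal
  have hmd : Measurable fun g => ENNReal.ofReal (deltaTilde x₀ act c g ^ (γ₀ + 1)) :=
    ((measurable_deltaTilde hactm hcm).pow_const _).ennreal_ofReal
  refine lintegral_ne_top_of_drift
    (fun f hf => lintegral_act_piStar hact hactm hν n₀ hf)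
    (((measurable_id.dist measurable_const).pow_const _).ennreal_ofReal)
    (fun _ => ENNReal.ofReal_ne_top) hrA
    (ENNReal.mul_ne_top (ENNReal.ofReal_ne_top (r := (r / (r - 1)) ^ (γ₀ + 1))) hB.ne)
    fun x => ?_
  have hpt : ∀ g, ENNReal.ofReal (dist (act g x) x₀ ^ (γ₀ + 1)) ≤
      ENNReal.ofReal (r ^ (γ₀ + 1)) * ENNReal.ofReal (dist x x₀ ^ (γ₀ + 1)) *
          ENNReal.ofReal (c g ^ (γ₀ + 1)) +
        ENNReal.ofReal ((r / (r - 1)) ^ (γ₀ + 1)) *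
          ENNReal.ofReal (deltaTilde x₀ act c g ^ (γ₀ + 1)) := by
    intro g
    have hd : 0 ≤ deltaTilde x₀ act c g := zero_le_one.trans (one_le_deltaTilde hc0 g)
    have hcg := hc0 g
    rw [← ENNReal.ofReal_mul (by positivity), ← ENNReal.ofReal_mul (by positivity),
      ← ENNReal.ofReal_mul (by positivity), ← ENNReal.ofReal_add (by positivity) (by positivity)]
    refine ENNReal.ofReal_le_ofReal ?_
    have h1 : dist (act g x) x₀ ≤ c g * dist x x₀ + deltaTilde x₀ act c g := by
      have := dist_triangle (act g x) (act g x₀) x₀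
      have := hcLip g x x₀
      unfold deltaTilde
      linarith
    refine (Real.rpow_le_rpow dist_nonneg h1 hs).trans
      ((add_rpow_le_of_one_lt hr hs (by positivity) hd).trans (le_of_eq ?_))
    rw [Real.mul_rpow hcg dist_nonneg]
    ring
  refine (lintegral_mono hpt).trans (le_of_eq ?_)
  rw [lintegral_add_left (hmc.const_mul _), lintegral_const_mul _ hmc, lintegral_const_mul _ hmd]
  ring

lemma integrable_pfun_rpow {ν : Measure M} [IsProbabilityMeasure ν] {lam γ γ₀ : ℝ}
    (hl : 0 < lam) (hl' : lam ≤ 1) (hγ : 0 < γ) (hγle : γ ≤ γ₀)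
    (h : ∫⁻ x, ENNReal.ofReal (dist x x₀ ^ (γ₀ + 1)) ∂ν ≠ ⊤) :
    Integrable (fun x => pfun x₀ lam x ^ (γ + 1)) ν := by
  have hd : Integrable (fun x => dist x x₀ ^ (γ₀ + 1)) ν :=
    (lintegral_ofReal_ne_top_iff_integrable
      ((measurable_id.dist measurable_const).pow_const _).aestronglyMeasurable
      (ae_of_all _ fun x => Real.rpow_nonneg dist_nonneg _)).1 h
  refine ((integrable_const ((2 : ℝ) ^ (γ₀ + 1))).add (hd.const_mul (2 ^ (γ₀ + 1)))).mono'
    (continuous_pfun_rpow hl _).aestronglyMeasurable (ae_of_all _ fun x => ?_)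
  have hp := one_le_pfun (x₀ := x₀) hl x
  have hdx : 0 ≤ dist x x₀ := dist_nonneg
  rw [Real.norm_of_nonneg (Real.rpow_nonneg (by linarith) _)]
  refine (Real.rpow_le_rpow_of_exponent_le hp (by linarith : γ + 1 ≤ γ₀ + 1)).trans ?_
  have h1 : pfun x₀ lam x ≤ 1 + dist x x₀ := by
    unfold pfun
    nlinarith
  refine (Real.rpow_le_rpow (by linarith) h1 (by linarith)).trans ?_
  have := add_rpow_le_of_one_lt (one_lt_two) (show 0 ≤ γ₀ + 1 by linarith) zero_le_one hdx
  norm_num at this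
  simpa using this

end Moments

/-- Proposition 5.2: the four norms are pairwise equivalent on `𝓑_γ`, and
`𝓑_γ` equipped with any of them is a Banach space. Here `piStar π n₀` denotes `π^{*(n₀+1)}`. -/
theorem stmt4
    {M : Type*} [MetricSpace M] [ProperSpace M] [MeasurableSpace M] [BorelSpace M]
    {G : Type*} [Semigroup G] [MeasurableSpace G] [MeasurableMul₂ G]
    (x₀ : M) (act : G → M → M)
    (hact : ∀ (g h : G) (x : M), act (g * h) x = act g (act h x))
    (hactm : Measurable fun q : G × M => act q.1 q.2)
    (c : G → ℝ) (hcm : Measurable c)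
    (hc0 : ∀ g : G, 0 ≤ c g)
    (hcLip : ∀ (g : G) (x y : M), dist (act g x) (act g y) ≤ c g * dist x y)
    (hcMin : ∀ (g : G) (K : ℝ), 0 ≤ K →
      (∀ x y : M, dist (act g x) (act g y) ≤ K * dist x y) → c g ≤ K)
    (π : Measure G) [IsProbabilityMeasure π]
    -- condition 𝓗(γ₀)
    (γ₀ : ℝ) (hγ₀ : 0 < γ₀) (n₀ : ℕ)
    (hM : ∫⁻ g, ENNReal.ofReal (deltaTilde x₀ act c g ^ (γ₀ + 1)) ∂π < ⊤)
    (hM' : ∫⁻ g, ENNReal.ofReal (c g * deltaTilde x₀ act c g ^ (2 * γ₀)) ∂π < ⊤)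
    (hC : ∫⁻ g, ENNReal.ofReal (c g * max (c g) 1 ^ (2 * γ₀)) ∂(piStar π n₀) < 1)
    -- `λ₀ ∈ (0,1]` with `ϑ₀ < 1`
    (lam₀ : ℝ) (hlam₀ : 0 < lam₀) (hlam₀' : lam₀ ≤ 1)
    (hθ : ∫⁻ g, ENNReal.ofReal (c g * deltaFun x₀ act c lam₀ g ^ (2 * γ₀))
        ∂(piStar π n₀) < 1)
    -- the `P`-invariant probability measure
    (ν : Measure M) [IsProbabilityMeasure ν]
    (hν : Measure.map (fun q : G × M => act q.1 q.2) (π.prod ν) = ν)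
    (γ γt : ℝ) (hγpos : 0 < γ) (hγle : γ ≤ γ₀) (hγt : γ < γt) :
    -- the four norms are pairwise equivalent on `𝓑_γ`
    (∀ i j : Fin 4, ∃ C : ℝ, 0 < C ∧ ∀ f : M → ℂ, memB x₀ lam₀ γ f →
      fourNorms x₀ lam₀ γ γt ν i f ≤ C * fourNorms x₀ lam₀ γ γt ν j f) ∧
    -- `𝓑_γ` is complete for each of them
    (∀ i : Fin 4, ∀ u : ℕ → M → ℂ, (∀ n, memB x₀ lam₀ γ (u n)) →
      (∀ ε : ℝ, 0 < ε → ∃ N : ℕ, ∀ m ≥ N, ∀ n ≥ N,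
        fourNorms x₀ lam₀ γ γt ν i (u m - u n) < ε) →
      ∃ f : M → ℂ, memB x₀ lam₀ γ f ∧
        Tendsto (fun n => fourNorms x₀ lam₀ γ γt ν i (u n - f)) atTop (𝓝 0)) := by
  have hI : Integrable (fun x => pfun x₀ lam₀ x ^ (γ + 1)) ν :=
    integrable_pfun_rpow hlam₀ hlam₀' hγpos hγle
      (lintegral_dist_rpow_ne_top hact hactm hcm hc0 hcLip hcMin hγ₀ hM hC hν)
  have heq := fourNorms_equiv_baseNorm hlam₀ hγpos hγt hI
  refine ⟨fun i j => ?_, fun i u hu hC' => ?_⟩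
  · obtain ⟨C, hC0, hC1⟩ := heq i
    obtain ⟨D, hD0, hD1⟩ := heq j
    refine ⟨C * D, mul_pos hC0 hD0, fun f hf => ?_⟩
    rw [mul_assoc]
    exact (hC1 f hf).1.trans (mul_le_mul_of_nonneg_left (hD1 f hf).2 hC0.le)
  · obtain ⟨C, hC0, hC1⟩ := heq i
    obtain ⟨f, hf, hlim⟩ := exists_tendsto_baseNorm hlam₀ hγpos u hu fun ε hε => by
      obtain ⟨N, hN⟩ := hC' (ε / C) (by positivity)
      refine ⟨N, fun m hm n hn => ((hC1 _ ((hu m).sub (hu n))).2).trans_lt ?_⟩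
      rw [mul_comm]
      exact (lt_div_iff₀ hC0).1 (hN m hm n hn)
    refine ⟨f, hf, squeeze_zero (fun n => ?_) (fun n => (hC1 _ ((hu n).sub hf)).1)
      (by simpa using hlim.const_mul C)⟩
    have h0 : 0 ≤ baseNorm x₀ lam₀ γ (u n - f) :=
      add_nonneg (mGam_nonneg hlam₀) (norm_nonneg _)
    exact nonneg_of_mul_nonneg_right (h0.trans (hC1 _ ((hu n).sub hf)).2) hC0

end
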